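/- Let S be a finite commutative ring, m ≥ 2, and let N = N_m^σ(S^×) denote the image of the unit group S^× under the map x ↦ N_m^σ(x); N is a subgroup of S^×. For units a, b of S, the classes of skew (σ,a)- and skew (σ,b)-constacyclic codes of length m are Chen equivalent if and only if a·N = b·N. Consequently: if n ∤ m then the number of Chen isometry classes of families of skew (σ,a)-constacyclic codes of length m arising from nonassociative algebras S[t;σ]/S[t;σ](t^m−a) equals |S^×|/|N|; if n | m then N ⊆ S_0^×, every coset of N in S^× is either entirely contained in S_0^× or disjoint from S_0, the number of such classes arising from nonassociative algebras equals |S^×|/|N| − |S_0^×|/|N|, and there are additionally |S_0^×|/|N| Chen equivalence classes arising from associative algebras (i.e. those with a ∈ S_0^×). -/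

import Mathlib

/-- `Nsig σ i β = ∏_{j=0}^{i-1} σ^j(β)`. -/
def Nsig {S : Type*} [CommRing S] (σ : S ≃+* S) (i : ℕ) (β : S) : S :=
  ∏ j ∈ Finset.range i, (σ ^ j) β

/-- The coefficient vector of the monomial `c·t^k` in `S^m`. -/
def stdVec {S : Type*} [Ring S] (m k : ℕ) (c : S) : Fin m → S :=
  fun j => if (j : ℕ) = k then c else 0

/-- Left multiplication by `t`, followed by reduction modulo `f = t^m − ∑ a_i t^i`,
on coefficient vectors representing elements of the Petit algebra `S[t;σ]/S[t;σ]f`. -/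
def tmul {S : Type*} [Ring S] (σ : S ≃+* S) {m : ℕ} (a : Fin m → S)
    (c : Fin m → S) : Fin m → S :=
  fun j =>
    (if _ : (j : ℕ) = 0 then 0 else σ (c ⟨(j : ℕ) - 1, by have := j.isLt; omega⟩)) +
      σ (c ⟨m - 1, by have := j.isLt; omega⟩) * a j

/-- The multiplication of the Petit algebra `S[t;σ]/S[t;σ]f`, `f = t^m − ∑ a_i t^i`:
`g ∘ h` is the remainder of the skew-polynomial product `g·h` under right division by `f`. -/
def petitMul {S : Type*} [Ring S] (σ : S ≃+* S) {m : ℕ} (a : Fin m → S)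
    (g h : Fin m → S) : Fin m → S :=
  fun j => ∑ i : Fin m, g i * (tmul σ a)^[(i : ℕ)] h j

/-- The map `G_{τ,α} : ∑ d_i t^i ↦ ∑ τ(d_i) N_i^σ(α) t^i` on coefficient vectors. -/
def Gmap {S : Type*} [CommRing S] (σ τ : S ≃+* S) (α : S) {m : ℕ}
    (d : Fin m → S) : Fin m → S :=
  fun i => τ (d i) * Nsig σ (i : ℕ) α

/-- `G` is an isomorphism from the Petit algebra `S[t;σ]/S[t;σ](t^m − ∑ a_i t^i)` to the
Petit algebra `S[t;σ]/S[t;σ](t^m − ∑ b_i t^i)`: a bijective, additive, unital and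
multiplicative map on coefficient vectors. -/
def IsPetitIso {S : Type*} [Ring S] (σ : S ≃+* S) {m : ℕ} (a b : Fin m → S)
    (G : (Fin m → S) → (Fin m → S)) : Prop :=
  Function.Bijective G ∧ (∀ x y, G (x + y) = G x + G y) ∧
    G (stdVec m 0 1) = stdVec m 0 1 ∧
    (∀ x y, G (petitMul σ a x y) = petitMul σ b (G x) (G y))

/-- The map `G_{τ,α,k} : ∑ d_i t^i ↦ ∑ τ(d_i) (α t^k)^i mod_r h`, where
`h = t^m − ∑ b_i t^i`; one has `(α t^k)^i = N_i^{σ^k}(α) t^{k i}` in `S[t;σ]`. -/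
def Gmapk {S : Type*} [CommRing S] (σ τ : S ≃+* S) (α : S) (k : ℕ) {m : ℕ}
    (b : Fin m → S) (d : Fin m → S) : Fin m → S :=
  ∑ i : Fin m, (τ (d i) * Nsig (σ ^ k) (i : ℕ) α) • (tmul σ b)^[k * (i : ℕ)] (stdVec m 0 1)

/-- The norm-type monoid homomorphism `x ↦ N_m^σ(x) = ∏_{j<m} σ^j(x)` of `S`. -/
def NmapHom {S : Type*} [CommRing S] (σ : S ≃+* S) (m : ℕ) : S →* S where
  toFun x := ∏ j ∈ Finset.range m, (σ ^ j) x
  map_one' := by simp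
  map_mul' x y := by
    simp only [map_mul]
    exact Finset.prod_mul_distrib

/-- The classes of skew `(σ,a)`- and `(σ,b)`-constacyclic codes of length `m` are Chen
equivalent: there is an isomorphism `G_{id,α}` between the ambient Petit algebras. -/
def ChenEquivCon {S : Type*} [CommRing S] (σ : S ≃+* S) (m : ℕ) (a b : Sˣ) : Prop :=
  ∃ α : S, IsUnit α ∧
    IsPetitIso σ (stdVec m 0 (a : S)) (stdVec m 0 (b : S)) (Gmap σ (RingEquiv.refl S) α)

/-- The classes of skew `(σ,a)`- and `(σ,b)`-constacyclic codes of length `m` are Chen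
isometric: there is an isomorphism `G_{id,α,k}` between the ambient Petit algebras. -/
def ChenIsomCon {S : Type*} [CommRing S] (σ : S ≃+* S) (m : ℕ) (a b : Sˣ) : Prop :=
  ∃ (α : S) (k : ℕ), IsUnit α ∧ 1 ≤ k ∧
    IsPetitIso σ (stdVec m 0 (a : S)) (stdVec m 0 (b : S))
      (Gmapk σ (RingEquiv.refl S) α k (stdVec m 0 (b : S)))

/-- The Petit algebra `S[t;σ]/S[t;σ](t^m − ∑ a_i t^i)` is associative. -/
def PetitAssoc {S : Type*} [CommRing S] (σ : S ≃+* S) {m : ℕ} (a : Fin m → S) : Prop :=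
  ∀ x y z : Fin m → S,
    petitMul σ a (petitMul σ a x y) z = petitMul σ a x (petitMul σ a y z)

section PetitAlgebra

variable {S : Type*} [CommRing S] {σ : S ≃+* S} {m : ℕ}

lemma smul_stdVec (k : ℕ) (c d : S) : c • stdVec m k d = stdVec m k (c * d) := by
  funext j
  simp [stdVec]

lemma stdVec_injective {k : ℕ} (hk : k < m) {c d : S} (h : stdVec m k c = stdVec m k d) :
    c = d := by
  simpa [stdVec] using congrFun h ⟨k, hk⟩

lemma sum_stdVec (x : Fin m → S) : ∑ i : Fin m, stdVec m (i : ℕ) (x i) = x := by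
  funext j
  rw [Finset.sum_apply, Finset.sum_eq_single j]
  · simp [stdVec]
  · intro i _ hij
    have : (j : ℕ) ≠ i := fun h => hij (Fin.ext h.symm)
    simp [stdVec, this]
  · simp

lemma tmul_add (a x y : Fin m → S) : tmul σ a (x + y) = tmul σ a x + tmul σ a y := by
  funext j
  simp only [tmul, Pi.add_apply, map_add]
  split_ifs <;> ring

lemma tmul_smul (a : Fin m → S) (c : S) (x : Fin m → S) :
    tmul σ a (c • x) = σ c • tmul σ a x := by
  funext j
  simp only [tmul, Pi.smul_apply, smul_eq_mul, map_mul]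
  split_ifs <;> ring

lemma tmul_sum {ι : Type*} (s : Finset ι) (a : Fin m → S) (f : ι → Fin m → S) :
    tmul σ a (∑ i ∈ s, f i) = ∑ i ∈ s, tmul σ a (f i) :=
  map_sum (AddMonoidHom.mk' (tmul σ a) (tmul_add a)) f s

lemma iterate_tmul_smul (a : Fin m → S) (i : ℕ) (c : S) (x : Fin m → S) :
    (tmul σ a)^[i] (c • x) = (σ ^ i) c • (tmul σ a)^[i] x := by
  induction i with
  | zero => simp
  | succ i ih =>
    rw [Function.iterate_succ_apply', ih, tmul_smul, Function.iterate_succ_apply', pow_succ',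
      RingAut.mul_apply]

lemma iterate_tmul_add (a : Fin m → S) (i : ℕ) (x y : Fin m → S) :
    (tmul σ a)^[i] (x + y) = (tmul σ a)^[i] x + (tmul σ a)^[i] y := by
  induction i with
  | zero => simp
  | succ i ih => simp only [Function.iterate_succ_apply', ih, tmul_add]

lemma iterate_tmul_sum {ι : Type*} (s : Finset ι) (a : Fin m → S) (i : ℕ)
    (f : ι → Fin m → S) :
    (tmul σ a)^[i] (∑ j ∈ s, f j) = ∑ j ∈ s, (tmul σ a)^[i] (f j) :=
  map_sum (AddMonoidHom.mk' ((tmul σ a)^[i]) (iterate_tmul_add a i)) f s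

lemma tmul_stdVec_of_lt (a : Fin m → S) {k : ℕ} (hk : k + 1 < m) (c : S) :
    tmul σ a (stdVec m k c) = stdVec m (k + 1) (σ c) := by
  funext j
  have h1 : m - 1 ≠ k := by omega
  by_cases h0 : (j : ℕ) = 0
  · have h2 : (j : ℕ) ≠ k + 1 := by omega
    simp [tmul, stdVec, h0, h1]
  · by_cases h2 : (j : ℕ) = k + 1
    · simp [tmul, stdVec, h1, h2]
    · have h3 : (j : ℕ) - 1 ≠ k := by omega
      simp [tmul, stdVec, h0, h1, h2, h3]

lemma tmul_stdVec_last (hm : 0 < m) (a c : S) :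
    tmul σ (stdVec m 0 a) (stdVec m (m - 1) c) = stdVec m 0 (σ c * a) := by
  funext j
  by_cases h0 : (j : ℕ) = 0
  · simp [tmul, stdVec, h0]
  · have h3 : (j : ℕ) - 1 ≠ m - 1 := by have := j.isLt; omega
    simp [tmul, stdVec, h0, h3]

lemma iterate_tmul_stdVec_of_lt (a : Fin m → S) {k j : ℕ} (h : k + j < m) (c : S) :
    (tmul σ a)^[j] (stdVec m k c) = stdVec m (k + j) ((σ ^ j) c) := by
  induction j with
  | zero => simp
  | succ j ih =>
    rw [Function.iterate_succ_apply', ih (by omega), tmul_stdVec_of_lt _ (by omega), pow_succ',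
      RingAut.mul_apply, add_assoc]

lemma iterate_tmul_stdVec_of_wrap (a : S) {k j e : ℕ} (hk : k < m) (he : e < m)
    (h : k + j = m + e) (c : S) :
    (tmul σ (stdVec m 0 a))^[j] (stdVec m k c) =
      stdVec m e ((σ ^ j) c * (σ ^ e) a) := by
  obtain ⟨l, rfl⟩ : ∃ l, m = k + l + 1 := ⟨m - k - 1, by omega⟩
  obtain rfl : j = e + (1 + l) := by omega
  rw [Function.iterate_add_apply, Function.iterate_add_apply,
    iterate_tmul_stdVec_of_lt _ (by omega), Function.iterate_one]
  have := tmul_stdVec_last (σ := σ) (m := k + l + 1) (by omega) a ((σ ^ l) c)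
  rw [Nat.add_sub_cancel] at this
  rw [this, iterate_tmul_stdVec_of_lt _ (by omega), map_mul, zero_add, pow_add, pow_add, pow_one]
  rfl

lemma exists_iterate_tmul_stdVec_zero (hm : 0 < m) (b : Sˣ) (j : ℕ) :
    ∃ w : Sˣ, (tmul σ (stdVec m 0 (b : S)))^[j] (stdVec m 0 1) = stdVec m (j % m) (w : S) := by
  induction j with
  | zero => exact ⟨1, by simp⟩
  | succ j ih =>
    obtain ⟨w, hw⟩ := ih
    rw [Function.iterate_succ_apply', hw]
    have hlt := Nat.mod_lt j hm
    by_cases h : j % m + 1 < m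
    · refine ⟨Units.map (σ : S →* S) w, ?_⟩
      rw [tmul_stdVec_of_lt _ h, Nat.add_mod, Nat.mod_eq_of_lt (show 1 < m by omega),
        Nat.mod_eq_of_lt h]
      rfl
    · refine ⟨Units.map (σ : S →* S) w * b, ?_⟩
      have h1 : j % m = m - 1 := by omega
      have h2 : (j + 1) % m = 0 := by
        rw [← Nat.mod_add_mod, h1, Nat.sub_add_cancel hm, Nat.mod_self]
      rw [h1, tmul_stdVec_last hm, h2]
      rfl

lemma petitMul_eq_sum (a x y : Fin m → S) :
    petitMul σ a x y = ∑ i : Fin m, x i • (tmul σ a)^[(i : ℕ)] y := by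
  funext j
  simp [petitMul]

lemma petitMul_stdVec (a : Fin m → S) {k : ℕ} (hk : k < m) (c : S) (y : Fin m → S) :
    petitMul σ a (stdVec m k c) y = c • (tmul σ a)^[k] y := by
  rw [petitMul_eq_sum, Finset.sum_eq_single ⟨k, hk⟩]
  · simp [stdVec]
  · intro i _ hi
    have : (i : ℕ) ≠ k := fun h => hi (Fin.ext h)
    simp [stdVec, this]
  · simp

lemma petitMul_add_left (a x y z : Fin m → S) :
    petitMul σ a (x + y) z = petitMul σ a x z + petitMul σ a y z := by
  simp only [petitMul_eq_sum, Pi.add_apply, add_smul, Finset.sum_add_distrib]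

lemma petitMul_smul_left (a : Fin m → S) (c : S) (x z : Fin m → S) :
    petitMul σ a (c • x) z = c • petitMul σ a x z := by
  simp only [petitMul_eq_sum, Pi.smul_apply, smul_assoc, Finset.smul_sum]

lemma petitMul_sum_left {ι : Type*} (s : Finset ι) (a : Fin m → S) (f : ι → Fin m → S)
    (z : Fin m → S) :
    petitMul σ a (∑ i ∈ s, f i) z = ∑ i ∈ s, petitMul σ a (f i) z :=
  map_sum (AddMonoidHom.mk' (fun x => petitMul σ a x z)
    (fun x y => petitMul_add_left a x y z)) f s

lemma iterate_tmul_length {a : S} (ha : σ a = a) (hσ : σ ^ m = 1) (z : Fin m → S) :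
    (tmul σ (stdVec m 0 a))^[m] z = a • z := by
  have hpow : ∀ i : ℕ, (σ ^ i) a = a := fun i => by
    induction i with
    | zero => rfl
    | succ i ih => rw [pow_succ, RingAut.mul_apply, ha, ih]
  conv_lhs => rw [← sum_stdVec z]
  conv_rhs => rw [← sum_stdVec z]
  rw [iterate_tmul_sum, Finset.smul_sum]
  refine Finset.sum_congr rfl fun i _ => ?_
  rw [iterate_tmul_stdVec_of_wrap a i.isLt i.isLt (by omega), smul_stdVec, hpow, hσ, mul_comm]
  rfl

lemma petitMul_tmul_left {a : S} (ha : σ a = a) (hσ : σ ^ m = 1) (y z : Fin m → S) :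
    petitMul σ (stdVec m 0 a) (tmul σ (stdVec m 0 a) y) z =
      tmul σ (stdVec m 0 a) (petitMul σ (stdVec m 0 a) y z) := by
  rw [petitMul_eq_sum _ y z, tmul_sum]
  conv_lhs => rw [← sum_stdVec y]
  rw [tmul_sum, petitMul_sum_left]
  refine Finset.sum_congr rfl fun i _ => ?_
  rw [tmul_smul, ← Function.iterate_succ_apply' (tmul σ (stdVec m 0 a))]
  have hi := i.isLt
  by_cases h : (i : ℕ) + 1 < m
  · rw [tmul_stdVec_of_lt _ h, petitMul_stdVec _ h]
  · have h1 : (i : ℕ) = m - 1 := by omega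
    have h2 : Nat.succ (m - 1) = m := by omega
    rw [h1, tmul_stdVec_last (by omega), petitMul_stdVec _ (by omega), h2,
      iterate_tmul_length ha hσ, smul_smul]
    rfl

lemma petitAssoc_of_fixed {a : S} (ha : σ a = a) (hσ : σ ^ m = 1) :
    PetitAssoc σ (stdVec m 0 a) := by
  have key : ∀ (i : ℕ) (y z : Fin m → S),
      petitMul σ (stdVec m 0 a) ((tmul σ (stdVec m 0 a))^[i] y) z =
        (tmul σ (stdVec m 0 a))^[i] (petitMul σ (stdVec m 0 a) y z) := by
    intro i y z
    induction i with
    | zero => rfl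
    | succ i ih =>
      rw [Function.iterate_succ_apply', petitMul_tmul_left ha hσ, ih,
        Function.iterate_succ_apply']
  intro x y z
  rw [petitMul_eq_sum _ x y, petitMul_eq_sum _ x, petitMul_sum_left]
  exact Finset.sum_congr rfl fun i _ => by rw [petitMul_smul_left, key]

lemma fixed_of_petitAssoc (hm : 2 ≤ m) (a : Sˣ) (h : PetitAssoc σ (stdVec m 0 (a : S))) :
    σ (a : S) = a ∧ σ ^ m = 1 := by
  have hT : petitMul σ (stdVec m 0 (a : S)) (stdVec m 1 1) (stdVec m (m - 1) 1) =
      stdVec m 0 (a : S) := by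
    rw [petitMul_stdVec _ (by omega), Function.iterate_one, tmul_stdVec_last (by omega)]
    simp
  constructor
  · have h1 := h (stdVec m 1 1) (stdVec m (m - 1) 1) (stdVec m 1 1)
    rw [hT, petitMul_stdVec _ (by omega), petitMul_stdVec _ (by omega),
      petitMul_stdVec _ (by omega),
      iterate_tmul_stdVec_of_wrap (a : S) (k := 1) (j := m - 1) (e := 0) (by omega) (by omega)
        (by omega), one_smul, one_smul, Function.iterate_one, tmul_stdVec_of_lt _ (by omega),
      Function.iterate_zero, id_eq, smul_stdVec] at h1
    simpa using (stdVec_injective (by omega) h1).symm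
  · refine RingEquiv.ext fun s => ?_
    have h1 := h (stdVec m 1 1) (stdVec m (m - 1) 1) (stdVec m 0 s)
    rw [hT, petitMul_stdVec _ (by omega), petitMul_stdVec _ (by omega),
      petitMul_stdVec _ (by omega),
      iterate_tmul_stdVec_of_lt _ (k := 0) (j := m - 1) (by omega), one_smul, one_smul,
      Function.iterate_one, Function.iterate_zero, id_eq, zero_add, tmul_stdVec_last (by omega), smul_stdVec] at h1
    have h2 := stdVec_injective (by omega) h1
    rw [mul_comm, ← RingAut.mul_apply, ← pow_succ', Nat.sub_add_cancel (by omega)] at h2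
    exact (a.isUnit.mul_right_cancel h2).symm

lemma Nsig_succ' (σ : S ≃+* S) (i : ℕ) (β : S) : Nsig σ (i + 1) β = β * σ (Nsig σ i β) := by
  simp only [Nsig, Finset.prod_range_succ', map_prod, pow_succ', RingAut.mul_apply]
  simp [mul_comm]

lemma Nsig_succ (σ : S ≃+* S) (i : ℕ) (β : S) : Nsig σ (i + 1) β = Nsig σ i β * (σ ^ i) β :=
  Finset.prod_range_succ _ _

lemma isUnit_Nsig (σ : S ≃+* S) (i : ℕ) {β : S} (h : IsUnit β) : IsUnit (Nsig σ i β) := by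
  induction i with
  | zero => simp [Nsig]
  | succ i ih => rw [Nsig_succ]; exact ih.mul (h.map (σ ^ i))

lemma iterate_smul_tmul (b : Fin m → S) (α : S) (i : ℕ) (y : Fin m → S) :
    (fun z => α • tmul σ b z)^[i] y = Nsig σ i α • (tmul σ b)^[i] y := by
  induction i with
  | zero => simp [Nsig]
  | succ i ih =>
    rw [Function.iterate_succ_apply', ih, tmul_smul, smul_smul, Nsig_succ',
      Function.iterate_succ_apply']

lemma Gmap_add (τ : S ≃+* S) (α : S) (x y : Fin m → S) :
    Gmap σ τ α (x + y) = Gmap σ τ α x + Gmap σ τ α y := by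
  funext j
  simp [Gmap, add_mul]

lemma Gmap_stdVec (k : ℕ) (α c : S) :
    Gmap σ (RingEquiv.refl S) α (stdVec m k c) = stdVec m k (c * Nsig σ k α) := by
  funext j
  by_cases h : (j : ℕ) = k <;> simp [Gmap, stdVec, h]

lemma Gmap_tmul (hm : 0 < m) {a b α : S} (h : a = Nsig σ m α * b) (y : Fin m → S) :
    Gmap σ (RingEquiv.refl S) α (tmul σ (stdVec m 0 a) y) =
      α • tmul σ (stdVec m 0 b) (Gmap σ (RingEquiv.refl S) α y) := by
  obtain ⟨l, rfl⟩ : ∃ l, m = l + 1 := ⟨m - 1, by omega⟩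
  funext ⟨j, hj⟩
  rcases j with _ | j
  · have h0 : Nsig σ 0 α = 1 := by simp [Nsig]
    simp only [Gmap, tmul, stdVec, h, Nsig_succ', h0, RingEquiv.refl_apply, map_mul, dite_true,
      if_true, Pi.smul_apply, smul_eq_mul, Nat.add_sub_cancel]
    ring
  · simp [Gmap, tmul, stdVec, Nsig_succ']
    ring

lemma isPetitIso_Gmap (hm : 0 < m) {a b α : S} (hα : IsUnit α) (h : a = Nsig σ m α * b) :
    IsPetitIso σ (stdVec m 0 a) (stdVec m 0 b) (Gmap σ (RingEquiv.refl S) α) := by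
  refine ⟨⟨fun x y hxy => ?_, fun y => ?_⟩, Gmap_add _ _, ?_, fun x y => ?_⟩
  · funext i
    exact (isUnit_Nsig σ i hα).mul_right_cancel (congrFun hxy i)
  · refine ⟨fun i => y i * ↑(isUnit_Nsig σ i hα).unit⁻¹, ?_⟩
    funext i
    simp [Gmap, mul_assoc]
  · rw [Gmap_stdVec]
    simp [Nsig]
  · have key : ∀ i : ℕ, Gmap σ (RingEquiv.refl S) α ((tmul σ (stdVec m 0 a))^[i] y) =
        Nsig σ i α • (tmul σ (stdVec m 0 b))^[i] (Gmap σ (RingEquiv.refl S) α y) := by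
      intro i
      rw [← iterate_smul_tmul]
      have hsemi : Function.Semiconj (Gmap σ (RingEquiv.refl S) α) (tmul σ (stdVec m 0 a))
          (fun z => α • tmul σ (stdVec m 0 b) z) := Gmap_tmul hm h
      exact hsemi.iterate_right i y
    rw [petitMul_eq_sum, petitMul_eq_sum]
    have hs := map_sum (AddMonoidHom.mk' (Gmap (m := m) σ (RingEquiv.refl S) α) (Gmap_add _ _))
      (fun i : Fin m => x i • (tmul σ (stdVec m 0 a))^[(i : ℕ)] y) Finset.univ
    refine hs.trans (Finset.sum_congr rfl fun i _ => ?_)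
    have hsmul : ∀ (c : S) (z : Fin m → S), Gmap σ (RingEquiv.refl S) α (c • z) =
        c • Gmap σ (RingEquiv.refl S) α z := fun c z => by
      funext j
      simp [Gmap, mul_assoc]
    rw [AddMonoidHom.mk'_apply, hsmul, key, smul_smul]
    rfl

/-- A unital multiplicative map fixing the constants and sending `t` to `β t` forces
`a = N_m(β) b`. -/
lemma eq_Nsig_mul_of_map_mul (hm : 2 ≤ m) {a b β : S} {G : (Fin m → S) → (Fin m → S)}
    (hmul : ∀ x y, G (petitMul σ (stdVec m 0 a) x y) =
      petitMul σ (stdVec m 0 b) (G x) (G y))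
    (hconst : ∀ c, G (stdVec m 0 c) = stdVec m 0 c)
    (ht : G (stdVec m 1 1) = stdVec m 1 β) : a = Nsig σ m β * b := by
  have hstep : ∀ y, G (tmul σ (stdVec m 0 a) y) = β • tmul σ (stdVec m 0 b) (G y) := fun y => by
    have := hmul (stdVec m 1 1) y
    rwa [ht, petitMul_stdVec _ (by omega), petitMul_stdVec _ (by omega), one_smul,
      Function.iterate_one, Function.iterate_one] at this
  have hpow : ∀ i, i < m → G (stdVec m i 1) = stdVec m i (Nsig σ i β) := by
    intro i
    induction i with
    | zero => intro _; rw [hconst]; simp [Nsig]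
    | succ i ih =>
      intro hi
      have := hstep (stdVec m i 1)
      rwa [ih (by omega), tmul_stdVec_of_lt _ hi, tmul_stdVec_of_lt _ hi, map_one, smul_stdVec,
        ← Nsig_succ'] at this
  have := hstep (stdVec m (m - 1) 1)
  rw [hpow _ (by omega), tmul_stdVec_last (by omega), tmul_stdVec_last (by omega), map_one,
    one_mul, hconst, smul_stdVec, ← mul_assoc, ← Nsig_succ', Nat.sub_add_cancel (by omega)] at this
  exact stdVec_injective (by omega) this

lemma chenEquivCon_iff (hm : 2 ≤ m) (a b : Sˣ) :
    ChenEquivCon σ m a b ↔ ∃ β : Sˣ, (a : S) = Nsig σ m (β : S) * b := by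
  constructor
  · rintro ⟨α, hα, -, -, -, hmul⟩
    refine ⟨hα.unit, eq_Nsig_mul_of_map_mul hm hmul (fun c => ?_) ?_⟩
    · rw [Gmap_stdVec]; simp [Nsig]
    · rw [Gmap_stdVec]; simp [Nsig]
  · rintro ⟨β, h⟩
    exact ⟨β, β.isUnit, isPetitIso_Gmap (by omega) β.isUnit h⟩

lemma Gmapk_stdVec (b : Fin m → S) {i : ℕ} (hi : i < m) (k : ℕ) (α c : S) :
    Gmapk σ (RingEquiv.refl S) α k b (stdVec m i c) =
      (c * Nsig (σ ^ k) i α) • (tmul σ b)^[k * i] (stdVec m 0 1) := by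
  rw [Gmapk, Finset.sum_eq_single ⟨i, hi⟩]
  · simp [stdVec]
  · intro j _ hj
    have : (j : ℕ) ≠ i := fun h => hj (Fin.ext h)
    simp [stdVec, this]
  · simp

lemma Gmapk_one (b : Fin m → S) (α : S) :
    Gmapk σ (RingEquiv.refl S) α 1 b = Gmap σ (RingEquiv.refl S) α := by
  funext d
  conv_rhs => rw [← sum_stdVec (Gmap σ (RingEquiv.refl S) α d)]
  refine Finset.sum_congr rfl fun i _ => ?_
  rw [one_mul, iterate_tmul_stdVec_of_lt _ (by simp), smul_stdVec]
  simp [Gmap]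

/-- If an isomorphism sends `t` to a unit multiple of `t ^ r` with `2 ≤ r < m`, then the target
Petit algebra is associative. -/
lemma petitAssoc_of_two_le {a b : Sˣ} {G : (Fin m → S) → (Fin m → S)} {r p : ℕ} (hr : 2 ≤ r)
    (hrm : r < m) (hp : p = (m - 1) / r) (hsurj : Function.Surjective G)
    (hmul : ∀ x y, G (petitMul σ (stdVec m 0 (a : S)) x y) =
      petitMul σ (stdVec m 0 (b : S)) (G x) (G y)) {u v : Sˣ}
    (hu : G (stdVec m 1 1) = stdVec m r (u : S))
    (hv : G (stdVec m p 1) = stdVec m (r * p) (v : S)) :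
    PetitAssoc σ (stdVec m 0 (b : S)) := by
  have hrp : r * p ≤ m - 1 := by rw [hp]; exact Nat.mul_div_le _ _
  have hrp' : m - 1 < r * p + r := by
    have := Nat.lt_mul_div_succ (m - 1) (show 0 < r by omega)
    rw [← hp] at this
    linarith
  have hpm : p + 1 < m := by
    have : 2 * p ≤ r * p := Nat.mul_le_mul_right _ hr
    omega
  obtain ⟨e, he⟩ : ∃ e, r * p + r = m + e := ⟨r * p + r - m, by omega⟩
  have hassoc : ∀ Z, petitMul σ (stdVec m 0 (b : S))
      (petitMul σ (stdVec m 0 (b : S)) (stdVec m r (u : S)) (stdVec m (r * p) (v : S))) Z =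
      petitMul σ (stdVec m 0 (b : S)) (stdVec m r (u : S))
        (petitMul σ (stdVec m 0 (b : S)) (stdVec m (r * p) (v : S)) Z) := by
    intro Z
    obtain ⟨z, rfl⟩ := hsurj Z
    rw [← hu, ← hv, ← hmul, ← hmul, ← hmul, ← hmul]
    congr 1
    rw [petitMul_stdVec _ (by omega) 1 (stdVec m p 1), petitMul_stdVec _ (by omega) 1 z,
      petitMul_stdVec _ (by omega), one_smul, one_smul, one_smul, Function.iterate_one,
      tmul_stdVec_of_lt _ hpm, map_one, petitMul_stdVec _ hpm, one_smul,
      Function.iterate_succ_apply']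
  have hprod : petitMul σ (stdVec m 0 (b : S)) (stdVec m r (u : S)) (stdVec m (r * p) (v : S)) =
      stdVec m e ((u : S) * ((σ ^ r) (v : S) * (σ ^ e) (b : S))) := by
    rw [petitMul_stdVec _ hrm, iterate_tmul_stdVec_of_wrap _ (by omega) (by omega) he,
      smul_stdVec]
  have hassoc' : ∀ Z, ((u : S) * (σ ^ r) (v : S)) •
      ((σ ^ e) (b : S) • (tmul σ (stdVec m 0 (b : S)))^[e] Z) =
      ((u : S) * (σ ^ r) (v : S)) • (tmul σ (stdVec m 0 (b : S)))^[m + e] Z := by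
    intro Z
    have := hassoc Z
    rw [hprod, petitMul_stdVec _ (by omega), petitMul_stdVec _ (by omega),
      petitMul_stdVec _ (by omega), iterate_tmul_smul, ← Function.iterate_add_apply,
      add_comm r, he, smul_smul] at this
    rw [smul_smul, mul_assoc, this]
  have hw : IsUnit ((u : S) * (σ ^ r) (v : S)) := u.isUnit.mul (v.isUnit.map (σ ^ r))
  have hcore : ∀ Z, (σ ^ e) (b : S) • (tmul σ (stdVec m 0 (b : S)))^[e] Z =
      (tmul σ (stdVec m 0 (b : S)))^[m + e] Z := fun Z => hw.smul_left_cancel.1 (hassoc' Z)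
  have hσ : σ ^ m = 1 := by
    have : σ ^ (m + e) = σ ^ e := by
      refine RingEquiv.ext fun s => ?_
      have h1 := hcore (stdVec m 0 s)
      rw [iterate_tmul_stdVec_of_lt _ (by omega),
        iterate_tmul_stdVec_of_wrap _ (by omega) (by omega) (zero_add _), zero_add,
        smul_stdVec] at h1
      have h2 := stdVec_injective (by omega) h1
      rw [mul_comm] at h2
      exact ((b.isUnit.map (σ ^ e)).mul_right_cancel h2).symm
    rw [pow_add] at this
    exact mul_eq_right.1 this
  refine petitAssoc_of_fixed ?_ hσ
  have h1 := hcore (stdVec m 1 1)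
  rw [iterate_tmul_stdVec_of_lt _ (by omega),
    iterate_tmul_stdVec_of_wrap _ (e := e + 1) (by omega) (by omega) (by omega),
    smul_stdVec, add_comm 1 e] at h1
  have h2 := stdVec_injective (by omega) h1
  rw [map_one, map_one, mul_one, one_mul, pow_succ, RingAut.mul_apply] at h2
  exact ((σ ^ e).injective h2).symm

lemma chenIsomCon_iff (hm : 2 ≤ m) (a b : Sˣ) (hb : ¬ PetitAssoc σ (stdVec m 0 (b : S))) :
    ChenIsomCon σ m a b ↔ ∃ β : Sˣ, (a : S) = Nsig σ m (β : S) * b := by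
  constructor
  · rintro ⟨α, k, hα, -, ⟨hinj, hsurj⟩, -, -, hmul⟩
    set G := Gmapk (m := m) σ (RingEquiv.refl S) α k (stdVec m 0 (b : S)) with hG
    have hmon : ∀ i, i < m → ∃ v : Sˣ, G (stdVec m i 1) = stdVec m (k * i % m) (v : S) := by
      intro i hi
      obtain ⟨w, hw⟩ := exists_iterate_tmul_stdVec_zero (σ := σ) (m := m) (by omega) b (k * i)
      refine ⟨(isUnit_Nsig (σ ^ k) i hα).unit * w, ?_⟩
      rw [hG, Gmapk_stdVec _ hi, hw, smul_stdVec]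
      simp
    have hconst : ∀ c, G (stdVec m 0 c) = stdVec m 0 c := by
      intro c
      rw [hG, Gmapk_stdVec _ (by omega), mul_zero, Function.iterate_zero, id_eq, smul_stdVec]
      simp [Nsig]
    obtain ⟨u, hu⟩ := hmon 1 (by omega)
    rw [mul_one] at hu
    have hr := Nat.mod_lt k (show m > 0 by omega)
    obtain h0 | h1 | h2 : k % m = 0 ∨ k % m = 1 ∨ 2 ≤ k % m := by omega
    · rw [h0, ← hconst] at hu
      have h10 : (1 : S) = 0 := by
        simpa [stdVec] using congrFun (hinj hu) ⟨1, by omega⟩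
      have := subsingleton_of_zero_eq_one h10.symm
      exact absurd (fun x y z => Subsingleton.elim _ _) hb
    · rw [h1] at hu
      exact ⟨u, eq_Nsig_mul_of_map_mul hm hmul hconst hu⟩
    · have hle : k % m * ((m - 1) / (k % m)) ≤ m - 1 := Nat.mul_div_le _ _
      obtain ⟨v, hv⟩ := hmon ((m - 1) / (k % m))
        (lt_of_le_of_lt (Nat.div_le_self _ _) (by omega))
      rw [← Nat.mod_mul_mod, Nat.mod_eq_of_lt (lt_of_le_of_lt hle (by omega))] at hv
      exact absurd (petitAssoc_of_two_le h2 hr rfl hsurj hmul hu hv) hb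
  · intro h
    obtain ⟨α, hα, hiso⟩ := (chenEquivCon_iff hm a b).2 h
    exact ⟨α, 1, hα, le_rfl, by rwa [Gmapk_one]⟩

lemma exists_eq_Nsig_mul_iff (a b : Sˣ) :
    (∃ β : Sˣ, (a : S) = Nsig σ m (β : S) * b) ↔
      b⁻¹ * a ∈ (Units.map (NmapHom σ m)).range := by
  constructor
  · rintro ⟨β, h⟩
    refine ⟨β, ?_⟩
    rw [eq_inv_mul_iff_mul_eq]
    ext
    rw [h, mul_comm]
    rfl
  · rintro ⟨β, h⟩
    refine ⟨β, ?_⟩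
    rw [eq_inv_mul_iff_mul_eq] at h
    rw [← h, mul_comm]
    rfl

end PetitAlgebra

lemma image_mul_left_eq_iff {G : Type*} [Group G] (N : Subgroup G) (a b : G) :
    (a * ·) '' (N : Set G) = (b * ·) '' (N : Set G) ↔ b⁻¹ * a ∈ N := by
  constructor
  · intro h
    have : a ∈ (b * ·) '' (N : Set G) := h ▸ ⟨1, N.one_mem, mul_one a⟩
    obtain ⟨x, hx, rfl⟩ := this
    simpa using hx
  · intro h
    exact (leftCoset_eq_iff N).2 (by simpa using N.inv_mem h)

lemma card_subtype_eq_card_quot_mul {G : Type*} [Group G] [Finite G] (N : Subgroup G)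
    (P : G → Prop) (hP : ∀ a, P a → ∀ x ∈ N, P (a * x))
    (r : {u : G // P u} → {u : G // P u} → Prop) (hr : ∀ a b, r a b ↔ b.1⁻¹ * a.1 ∈ N) :
    Nat.card {u : G // P u} = Nat.card (Quot r) * Nat.card N := by
  have hequiv : Equivalence r := by
    refine ⟨fun a => (hr a a).2 (by simp), fun {a b} h => ?_, fun {a b c} h h' => ?_⟩
    · rw [hr] at h ⊢
      simpa using N.inv_mem h
    · rw [hr] at h h' ⊢
      simpa [mul_assoc] using N.mul_mem h' h
  have hfib : ∀ q : Quot r, Nat.card {b // Quot.mk r b = q} = Nat.card N := by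
    intro q
    induction q using Quot.ind with
    | mk a =>
      refine Nat.card_congr
        { toFun := fun b => ⟨a.1⁻¹ * b.1.1, (hr _ _).1 (hequiv.quot_mk_eq_iff _ _ |>.1 b.2)⟩
          invFun := fun x => ⟨⟨a.1 * x.1, hP _ a.2 _ x.2⟩,
            Quot.sound ((hr _ _).2 (by simp))⟩
          left_inv := fun b => by ext; simp
          right_inv := fun x => by ext; simp }
  have : Fintype (Quot r) := Fintype.ofFinite _
  rw [← Nat.card_congr (Equiv.sigmaFiberEquiv (Quot.mk r)), Nat.card_sigma,
    Nat.card_eq_fintype_card (α := Quot r)]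
  simp [hfib]

/-- **Theorem (counting Chen isometry classes over a finite ring).**  Let `S` be a finite
commutative ring and `N = N_m^σ(S^×) ≤ S^×`.  Units `a, b` give Chen equivalent classes of
skew constacyclic codes iff `aN = bN`.  If `n ∤ m`, the number of Chen isometry classes of
families of skew `(σ,a)`-constacyclic codes arising from nonassociative Petit algebras is
`|S^×|/|N|`; if `n ∣ m`, then `N ⊆ S_0^×`, every coset of `N` is entirely contained in
`S_0` or disjoint from it, the number of such classes arising from nonassociative algebras
is `|S^×|/|N| − |S_0^×|/|N|`, and there are additionally `|S_0^×|/|N|` Chen equivalence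
classes arising from associative algebras (those with `a ∈ S_0^×`). -/
theorem stmt9 {S : Type*} [CommRing S] [Finite S] (σ : S ≃+* S)
    (n : ℕ) (hn : 0 < n) (hord : orderOf σ = n) (m : ℕ) (hm : 2 ≤ m) :
    (∀ a b : Sˣ, ChenEquivCon σ m a b ↔
      (a * ·) '' ((Units.map (NmapHom σ m)).range : Set Sˣ)
        = (b * ·) '' ((Units.map (NmapHom σ m)).range : Set Sˣ)) ∧
    (¬ n ∣ m →
      Nat.card (Quot (fun a b : {u : Sˣ // ¬ PetitAssoc σ (stdVec m 0 (u : S))} =>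
          ChenIsomCon σ m a.1 b.1))
        = Nat.card Sˣ / Nat.card ((Units.map (NmapHom σ m)).range)) ∧
    (n ∣ m →
      (∀ u : Sˣ, u ∈ (Units.map (NmapHom σ m)).range → σ (u : S) = u) ∧
      (∀ a : Sˣ,
        (∀ x ∈ (a * ·) '' ((Units.map (NmapHom σ m)).range : Set Sˣ), σ (x : S) = x) ∨
        (∀ x ∈ (a * ·) '' ((Units.map (NmapHom σ m)).range : Set Sˣ), ¬ σ (x : S) = x)) ∧
      Nat.card (Quot (fun a b : {u : Sˣ // ¬ PetitAssoc σ (stdVec m 0 (u : S))} =>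
          ChenIsomCon σ m a.1 b.1))
        = Nat.card Sˣ / Nat.card ((Units.map (NmapHom σ m)).range)
            - Nat.card {u : Sˣ // σ (u : S) = u} /
                Nat.card ((Units.map (NmapHom σ m)).range) ∧
      Nat.card (Quot (fun a b : {u : Sˣ // σ (u : S) = (u : S)} => ChenEquivCon σ m a.1 b.1))
        = Nat.card {u : Sˣ // σ (u : S) = (u : S)} /
            Nat.card ((Units.map (NmapHom σ m)).range)) := by
  set N := (Units.map (NmapHom σ m)).range with hN
  have hNpos : 0 < Nat.card N := Nat.card_pos
  have hiff : ∀ a b : Sˣ, ChenEquivCon σ m a b ↔ b⁻¹ * a ∈ N := fun a b =>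
    (chenEquivCon_iff hm a b).trans (exists_eq_Nsig_mul_iff a b)
  have hdvd : n ∣ m ↔ σ ^ m = 1 := by rw [← hord]; exact orderOf_dvd_iff_pow_eq_one
  have hassoc : ∀ u : Sˣ, PetitAssoc σ (stdVec m 0 (u : S)) ↔ n ∣ m ∧ σ (u : S) = u := by
    intro u
    rw [hdvd]
    exact ⟨fun h => (fixed_of_petitAssoc hm u h).symm, fun h => petitAssoc_of_fixed h.2 h.1⟩
  have hisom : ∀ a b : {u : Sˣ // ¬ PetitAssoc σ (stdVec m 0 (u : S))},
      ChenIsomCon σ m a.1 b.1 ↔ b.1⁻¹ * a.1 ∈ N := fun a b =>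
    (chenIsomCon_iff hm a.1 b.1 b.2).trans (exists_eq_Nsig_mul_iff a.1 b.1)
  refine ⟨fun a b => by rw [hiff, image_mul_left_eq_iff], fun hnm => ?_, fun hnm => ?_⟩
  · have hcard := card_subtype_eq_card_quot_mul N _
      (fun a _ x _ => fun h => hnm ((hassoc (a * x)).1 h).1) _ hisom
    have hall : Nat.card {u : Sˣ // ¬ PetitAssoc σ (stdVec m 0 (u : S))} = Nat.card Sˣ :=
      Nat.card_congr (Equiv.subtypeUnivEquiv fun u h => hnm ((hassoc u).1 h).1)
    rw [← hall, hcard, Nat.mul_div_cancel _ hNpos]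
  · have hσ := hdvd.1 hnm
    have hfix : ∀ u : Sˣ, u ∈ N → σ (u : S) = u := by
      rintro u ⟨β, rfl⟩
      change σ (Nsig σ m (β : S)) = Nsig σ m (β : S)
      have h := (Nsig_succ' σ m (β : S)).symm.trans (Nsig_succ σ m (β : S))
      rw [hσ, mul_comm] at h
      exact β.isUnit.mul_right_cancel h
    have hmulfix : ∀ a x : Sˣ, x ∈ N → (σ ((a * x : Sˣ) : S) = (a * x : Sˣ) ↔ σ (a : S) = a) := by
      intro a x hx
      rw [Units.val_mul, map_mul, hfix x hx]
      exact x.isUnit.mul_left_inj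
    have hcard0 := card_subtype_eq_card_quot_mul N (fun u : Sˣ => σ (u : S) = u)
      (fun a ha x hx => (hmulfix a x hx).2 ha) (fun a b => ChenEquivCon σ m a.1 b.1)
      (fun a b => hiff a.1 b.1)
    have hcard1 := card_subtype_eq_card_quot_mul N _
      (fun a ha x hx => fun h => ha ((hassoc a).2
        ⟨hnm, (hmulfix a x hx).1 ((hassoc (a * x)).1 h).2⟩)) _ hisom
    refine ⟨hfix, fun a => ?_, ?_, ?_⟩
    · by_cases ha : σ (a : S) = a
      · left
        rintro _ ⟨x, hx, rfl⟩
        exact (hmulfix a x hx).2 ha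
      · right
        rintro _ ⟨x, hx, rfl⟩
        exact fun h => ha ((hmulfix a x hx).1 h)
    · have hcompl : Nat.card {u : Sˣ // ¬ PetitAssoc σ (stdVec m 0 (u : S))} =
          Nat.card {u : Sˣ // ¬ σ (u : S) = u} :=
        Nat.card_congr (Equiv.subtypeEquivRight fun u => by simp [hassoc, hnm])
      have hsum : Nat.card Sˣ = Nat.card {u : Sˣ // σ (u : S) = u} +
          Nat.card {u : Sˣ // ¬ σ (u : S) = u} := by
        classical
        rw [← Nat.card_sum]
        exact Nat.card_congr (Equiv.sumCompl _).symm
      rw [hsum, ← hcompl, hcard0, hcard1, ← add_mul, Nat.mul_div_cancel _ hNpos,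
        Nat.mul_div_cancel _ hNpos, Nat.add_sub_cancel_left]
    · rw [hcard0, Nat.mul_div_cancel _ hNpos]
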